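/- arXiv:2408.09246 — 6 statements merged into one kernel-verified Lean document; each statement's English description precedes it below -/
import Mathlib

section
/- Let q_D, q_B : ℝ → ℍ be differentiable curves of unit quaternions and let w_D, w_B : ℝ → ℍ be continuous curves of pure quaternions such that q_D'(t) = (1/2) · w_D(t) * q_D(t) and q_B'(t) = (1/2) · w_B(t) * q_B(t) for all t. Define the error quaternion q_e(t) = q_D(t) * (q_B(t))⁻¹. Then for all t, q_e'(t) = (1/2) · ( w_D(t) − q_e(t) * w_B(t) * (q_e(t))⁻¹ ) * q_e(t). -/
open Quaternion

/-- The derivative of the inverse of a curve in a normed division algebra. -/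
theorem HasDerivAt.inv_of_divisionRing {𝕜 R : Type*} [NontriviallyNormedField 𝕜]
    [NormedDivisionRing R] [NormedAlgebra 𝕜 R] {f : 𝕜 → R} {f' : R} {x : 𝕜}
    (hf : HasDerivAt f f' x) (hx : f x ≠ 0) :
    HasDerivAt (fun y => (f y)⁻¹) (-((f x)⁻¹ * f' * (f x)⁻¹)) x := by
  simpa [Function.comp_def] using (hasFDerivAt_inv' (𝕜 := 𝕜) hx).comp_hasDerivAt x hf

/-- **Error-quaternion kinematics (Eq. 7).**
If `q_D` and `q_B` are differentiable curves of unit quaternions whose derivatives satisfy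
the attitude kinematics `q̇ = (1/2)·w*q` with continuous pure-quaternion angular velocities
`w_D`, `w_B`, then the error quaternion `q_e = q_D * q_B⁻¹` satisfies
`q̇_e = (1/2)·(w_D − q_e * w_B * q_e⁻¹) * q_e`. -/
theorem error_quaternion_kinematics
    (q_D q_B w_D w_B : ℝ → ℍ[ℝ])
    (hunit_D : ∀ t, ‖q_D t‖ = 1) (hunit_B : ∀ t, ‖q_B t‖ = 1)
    (hpure_D : ∀ t, (w_D t).re = 0) (hpure_B : ∀ t, (w_B t).re = 0)
    (hcont_D : Continuous w_D) (hcont_B : Continuous w_B)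
    (hq_D : ∀ t, HasDerivAt q_D (((1 : ℝ) / 2) • (w_D t * q_D t)) t)
    (hq_B : ∀ t, HasDerivAt q_B (((1 : ℝ) / 2) • (w_B t * q_B t)) t) :
    ∀ t, HasDerivAt (fun s => q_D s * (q_B s)⁻¹)
      (((1 : ℝ) / 2) •
        ((w_D t - (q_D t * (q_B t)⁻¹) * w_B t * (q_D t * (q_B t)⁻¹)⁻¹) *
          (q_D t * (q_B t)⁻¹))) t := by
  intro t
  have ne_zero {q : ℍ[ℝ]} (hq : ‖q‖ = 1) : q ≠ 0 := norm_ne_zero_iff.mp (by simp [hq])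
  have hD := ne_zero (hunit_D t)
  have hB := ne_zero (hunit_B t)
  refine ((hq_D t).fun_mul ((hq_B t).inv_of_divisionRing hB)).congr_deriv ?_
  have he : q_D t * (q_B t)⁻¹ ≠ 0 := mul_ne_zero hD (inv_ne_zero hB)
  rw [sub_mul, inv_mul_cancel_right₀ he, mul_smul_comm, smul_mul_assoc, smul_mul_assoc,
    ← mul_assoc (q_B t)⁻¹, mul_inv_cancel_right₀ hB, mul_neg, mul_smul_comm, smul_sub,
    sub_eq_add_neg]
  simp only [mul_assoc]
end

section
/- Let q : ℝ → ℍ be a differentiable curve of unit quaternions and w : ℝ → ℝ³ a continuous curve such that q'(t) = (1/2) · w̄(t) * q(t), where w̄(t) is the pure quaternion with imaginary part w(t). Fix t with im(q(t)) ≠ 0 (equivalently |re(q(t))| < 1). Then the error angle θ(t) = 2·arccos(re(q(t))) is differentiable at t and θ'(t) = ⟨w(t), im(q(t))/‖im(q(t))‖⟩, i.e., the time derivative of the error angle equals the component of the angular velocity along the instantaneous eigen-axis (Eq. 10). -/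
open Quaternion RealInnerProductSpace

/-- The pure quaternion with imaginary part the vector `v ∈ ℝ³`. -/
noncomputable def pureQuat (v : EuclideanSpace ℝ (Fin 3)) : ℍ[ℝ] := ⟨0, v 0, v 1, v 2⟩

/-- The imaginary (vector) part of a quaternion, as a vector in `ℝ³`. -/
noncomputable def imVec (q : ℍ[ℝ]) : EuclideanSpace ℝ (Fin 3) :=
  (WithLp.equiv 2 (Fin 3 → ℝ)).symm ![q.imI, q.imJ, q.imK]

theorem Quaternion.hasDerivAt_re {q : ℝ → ℍ[ℝ]} {q' : ℍ[ℝ]} {t : ℝ} (h : HasDerivAt q q' t) :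
    HasDerivAt (fun s => (q s).re) q'.re t := by
  simpa [Quaternion.inner_def] using h.inner ℝ (hasDerivAt_const t (1 : ℍ[ℝ]))

theorem norm_imVec_sq (q : ℍ[ℝ]) : ‖imVec q‖ ^ 2 = ‖q‖ ^ 2 - q.re ^ 2 := by
  rw [EuclideanSpace.real_norm_sq_eq, sq ‖q‖, ← normSq_eq_norm_mul_self, normSq_def']
  simp [imVec, Fin.sum_univ_three]
  ring

theorem re_pureQuat_mul (v : EuclideanSpace ℝ (Fin 3)) (q : ℍ[ℝ]) :
    (pureQuat v * q).re = -⟪v, imVec q⟫ := by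
  rw [Quaternion.re_mul]
  simp [pureQuat, imVec, PiLp.inner_apply, Fin.sum_univ_three]
  ring

theorem imVec_eq_zero_iff {q : ℍ[ℝ]} : imVec q = 0 ↔ q.im = 0 := by
  simp [imVec, Quaternion.ext_iff]

/-- **Derivative of the error angle (Eq. 10).**
Let `q` be a differentiable curve of unit quaternions with `q̇ = (1/2)·w̄*q`, where `w̄(t)`
is the pure quaternion with imaginary part `w(t) ∈ ℝ³`.  At any time `t` where the
imaginary part of `q t` is nonzero, the error angle `θ(t) = 2·arccos(re (q t))` is
differentiable with `θ'(t) = ⟪w t, im(q t)/‖im(q t)‖⟫`, the component of the angular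
velocity along the instantaneous eigen-axis. -/
theorem error_angle_deriv
    (q : ℝ → ℍ[ℝ]) (w : ℝ → EuclideanSpace ℝ (Fin 3))
    (hunit : ∀ t, ‖q t‖ = 1)
    (hcont : Continuous w)
    (hq : ∀ t, HasDerivAt q (((1 : ℝ) / 2) • (pureQuat (w t) * q t)) t)
    (t : ℝ) (him : (q t).im ≠ 0) :
    HasDerivAt (fun s => 2 * Real.arccos ((q s).re))
      (⟪w t, (‖imVec (q t)‖)⁻¹ • imVec (q t)⟫) t := by
  have hsq : ‖imVec (q t)‖ ^ 2 = 1 - (q t).re ^ 2 := by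
    rw [norm_imVec_sq, hunit, one_pow]
  have hpos : 0 < ‖imVec (q t)‖ := norm_pos_iff.mpr (mt imVec_eq_zero_iff.mp him)
  have hsqrt : √(1 - (q t).re ^ 2) = ‖imVec (q t)‖ := by
    rw [← hsq, Real.sqrt_sq hpos.le]
  have hne_neg : (q t).re ≠ -1 := fun h => by rw [h] at hsq; nlinarith
  have hne : (q t).re ≠ 1 := fun h => by rw [h] at hsq; nlinarith
  refine (((Real.hasDerivAt_arccos hne_neg hne).comp t
    (Quaternion.hasDerivAt_re (hq t))).const_mul 2).congr_deriv ?_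
  rw [hsqrt, Quaternion.re_smul, re_pureQuat_mul, real_inner_smul_right, smul_eq_mul]
  field_simp
end

section
/- Let v : ℝ → ℝ³ be differentiable with v(t) ≠ 0 for all t, let a : ℝ → ℝ and w : ℝ → ℝ³ be continuous, and suppose v'(t) = (1/2) · ( a(t)·w(t) − w(t) × v(t) ) for all t (the vector part of the quaternion kinematics, with a the scalar part of the error quaternion and w the error angular velocity). Let ê(t) = v(t)/‖v(t)‖ and let w⊥(t) = w(t) − ⟨ê(t), w(t)⟩·ê(t) be the component of w perpendicular to ê. Then ê'(t) = (1/2) · ( (a(t)/‖v(t)‖)·w⊥(t) + ê(t) × w⊥(t) ). -/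
open RealInnerProductSpace

/-- The cross product on `ℝ³` (Euclidean space). -/
noncomputable def cross3 (a b : EuclideanSpace ℝ (Fin 3)) : EuclideanSpace ℝ (Fin 3) :=
  (WithLp.equiv 2 (Fin 3 → ℝ)).symm
    (crossProduct ((WithLp.equiv 2 (Fin 3 → ℝ)) a) ((WithLp.equiv 2 (Fin 3 → ℝ)) b))

theorem cross3_smul_left (c : ℝ) (x y : EuclideanSpace ℝ (Fin 3)) :
    cross3 (c • x) y = c • cross3 x y := by
  simp [cross3]

theorem cross3_smul_right (c : ℝ) (x y : EuclideanSpace ℝ (Fin 3)) :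
    cross3 x (c • y) = c • cross3 x y := by
  simp [cross3]

theorem cross3_sub_right (x y z : EuclideanSpace ℝ (Fin 3)) :
    cross3 x (y - z) = cross3 x y - cross3 x z := by
  simp [cross3]

theorem cross3_self (x : EuclideanSpace ℝ (Fin 3)) : cross3 x x = 0 := by
  simp [cross3]

theorem neg_cross3 (x y : EuclideanSpace ℝ (Fin 3)) : -cross3 x y = cross3 y x := by
  simp [cross3, ← WithLp.toLp_neg]

theorem inner_cross3_self (x y : EuclideanSpace ℝ (Fin 3)) : ⟪x, cross3 x y⟫ = 0 := by
  simp [cross3, PiLp.inner_apply, Fin.sum_univ_three, cross_apply]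
  ring

/-- The derivative of the normalization of a nonvanishing curve. -/
theorem HasDerivAt.inv_norm_smul {E : Type*} [NormedAddCommGroup E] [InnerProductSpace ℝ E]
    {f : ℝ → E} {f' : E} {t : ℝ} (hf : HasDerivAt f f' t) (h0 : f t ≠ 0) :
    HasDerivAt (fun s => ‖f s‖⁻¹ • f s)
      (‖f t‖⁻¹ • (f' - ⟪‖f t‖⁻¹ • f t, f'⟫ • (‖f t‖⁻¹ • f t))) t := by
  have hn : ‖f t‖ ≠ 0 := norm_ne_zero_iff.mpr h0
  have hnorm : HasDerivAt (fun s => ‖f s‖) (⟪f t, f'⟫ / ‖f t‖) t := by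
    have h := hf.norm_sq.sqrt (pow_ne_zero 2 hn)
    simp only [Real.sqrt_sq, norm_nonneg] at h
    convert h using 1
    field_simp
  refine ((hnorm.inv hn).smul hf).congr_deriv ?_
  simp only [inner_smul_left, conj_trivial, Pi.inv_apply]
  match_scalars <;> field_simp

/-- **Eigen-axis rate formula (Eq. 11).**
Let `v : ℝ → ℝ³` be differentiable and never zero, with
`v'(t) = (1/2)·(a(t)·w(t) − w(t) × v(t))` (the vector part of the quaternion kinematics,
`a` being the scalar part of the error quaternion and `w` the error angular velocity).
With `ê(t) = v(t)/‖v(t)‖` and `w⊥(t) = w(t) − ⟨ê(t), w(t)⟩·ê(t)`, the eigen-axis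
satisfies `ê'(t) = (1/2)·((a(t)/‖v(t)‖)·w⊥(t) + ê(t) × w⊥(t))`. -/
theorem eigen_axis_rate
    (v : ℝ → EuclideanSpace ℝ (Fin 3)) (a : ℝ → ℝ) (w : ℝ → EuclideanSpace ℝ (Fin 3))
    (hne : ∀ t, v t ≠ 0)
    (ha : Continuous a) (hw : Continuous w)
    (hv : ∀ t, HasDerivAt v (((1 : ℝ) / 2) • (a t • w t - cross3 (w t) (v t))) t) :
    ∀ t,
      HasDerivAt (fun s => (‖v s‖)⁻¹ • v s)
        (((1 : ℝ) / 2) •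
          ((a t / ‖v t‖) •
              (w t - ⟪(‖v t‖)⁻¹ • v t, w t⟫ • ((‖v t‖)⁻¹ • v t)) +
            cross3 ((‖v t‖)⁻¹ • v t)
              (w t - ⟪(‖v t‖)⁻¹ • v t, w t⟫ • ((‖v t‖)⁻¹ • v t)))) t := by
  intro t
  have hn : ‖v t‖ ≠ 0 := norm_ne_zero_iff.mpr (hne t)
  refine ((hv t).inv_norm_smul (hne t)).congr_deriv ?_
  rw [sub_eq_add_neg (a t • w t), neg_cross3]
  simp only [cross3_sub_right, cross3_smul_left, cross3_smul_right, cross3_self,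
    inner_smul_left, inner_smul_right, inner_add_right, inner_cross3_self, conj_trivial]
  match_scalars <;> field_simp
  ring
end

section
/- Let v : ℝ → ℝ³ be differentiable with v(t) ≠ 0 for all t, let a : ℝ → ℝ and w : ℝ → ℝ³ be continuous with v'(t) = (1/2)·( a(t)·w(t) − w(t) × v(t) ) for all t, and let ê(t) = v(t)/‖v(t)‖ and w⊥(t) = w(t) − ⟨ê(t), w(t)⟩·ê(t). If at some time t₀ the perpendicular component vanishes, w⊥(t₀) = 0, then ê'(t₀) = 0, even if w(t₀) ≠ 0; i.e., when the off-axis error rate is zero the instantaneous eigen-axis is stationary (Remark 2). -/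
open RealInnerProductSpace

theorem cross3_smul_self (c : ℝ) (x : EuclideanSpace ℝ (Fin 3)) : cross3 (c • x) x = 0 := by
  simp [cross3]

/-- If the velocity of a curve is radial at some time, then its direction is stationary there. -/
theorem hasDerivAt_inv_norm_smul_zero_of_radial {E : Type*} [NormedAddCommGroup E]
    [InnerProductSpace ℝ E] {f : ℝ → E} {k t : ℝ} (hf : HasDerivAt f (k • f t) t)
    (h0 : f t ≠ 0) : HasDerivAt (fun s => (‖f s‖)⁻¹ • f s) 0 t := by
  have hn : ‖f t‖ ≠ 0 := norm_ne_zero_iff.mpr h0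
  have hnorm : HasDerivAt (fun s => ‖f s‖) (k * ‖f t‖) t := by
    have h := hf.norm_sq.sqrt (pow_ne_zero 2 hn)
    simp only [Real.sqrt_sq (norm_nonneg _), real_inner_smul_right,
      real_inner_self_eq_norm_sq] at h
    convert h using 1
    field_simp
  convert (hnorm.fun_inv hn).fun_smul hf using 1
  rw [smul_smul, ← add_smul]
  have hk : ‖f t‖⁻¹ * k + -(k * ‖f t‖) / ‖f t‖ ^ 2 = 0 := by
    field_simp
    ring
  rw [hk, zero_smul]

/-- **Stationary eigen-axis when the off-axis rate vanishes (Remark 2).**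
Let `v : ℝ → ℝ³` be differentiable and never zero, with
`v'(t) = (1/2)·(a(t)·w(t) − w(t) × v(t))`, and let `ê(t) = v(t)/‖v(t)‖` and
`w⊥(t) = w(t) − ⟨ê(t), w(t)⟩·ê(t)`.  If at some time `t₀` the perpendicular component
vanishes, `w⊥(t₀) = 0`, then `ê'(t₀) = 0`: the instantaneous eigen-axis is stationary. -/
theorem eigen_axis_stationary_of_perp_zero
    (v : ℝ → EuclideanSpace ℝ (Fin 3)) (a : ℝ → ℝ) (w : ℝ → EuclideanSpace ℝ (Fin 3))
    (hne : ∀ t, v t ≠ 0)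
    (ha : Continuous a) (hw : Continuous w)
    (hv : ∀ t, HasDerivAt v (((1 : ℝ) / 2) • (a t • w t - cross3 (w t) (v t))) t)
    (t₀ : ℝ)
    (hperp : w t₀ - ⟪(‖v t₀‖)⁻¹ • v t₀, w t₀⟫ • ((‖v t₀‖)⁻¹ • v t₀) = 0) :
    HasDerivAt (fun s => (‖v s‖)⁻¹ • v s) 0 t₀ := by
  obtain ⟨c, hc⟩ : ∃ c : ℝ, w t₀ = c • v t₀ :=
    ⟨_, (sub_eq_zero.mp hperp).trans (smul_smul _ _ _)⟩
  refine hasDerivAt_inv_norm_smul_zero_of_radial (k := 1 / 2 * (a t₀ * c)) ?_ (hne t₀)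
  have h := hv t₀
  rwa [hc, cross3_smul_self, sub_zero, smul_smul, smul_smul, mul_assoc] at h
end

section
/- Let J be a symmetric positive-definite real 3×3 matrix with smallest eigenvalue λ_min(J) and largest eigenvalue λ_max(J), let d_max ≥ 0, β₁ > 0 and 0 < β₂ < 1, let s ∈ ℝ³ with s ≠ 0 and ŝ = s/‖s‖, and let d ∈ ℝ³ with ‖d‖ ≤ d_max. Then sᵀ J ( −J⁻¹(d_max·ŝ + d) − β₁‖s‖^{β₂}·ŝ ) ≤ −β₁ λ_min(J) ‖s‖^{β₂+1}; consequently, setting V = (1/2) sᵀ J s, this quantity is at most −β₁ λ_min(J) (2V/λ_max(J))^{(β₂+1)/2}. -/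
open RealInnerProductSpace

open Matrix in
/-- The quadratic form of a real symmetric matrix in the coordinates of an orthonormal eigenbasis. -/
lemma Matrix.IsHermitian.inner_toEuclideanLin_self {n : Type*} [Fintype n] [DecidableEq n]
    {A : Matrix n n ℝ} (hA : A.IsHermitian) (x : EuclideanSpace ℝ n) :
    ⟪x, toEuclideanLin A x⟫ = ∑ i, hA.eigenvalues i * ⟪hA.eigenvectorBasis i, x⟫ ^ 2 := by
  rw [← hA.eigenvectorBasis.sum_inner_mul_inner x (toEuclideanLin A x)]
  refine Finset.sum_congr rfl fun i _ => ?_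
  have hb : toEuclideanLin A (hA.eigenvectorBasis i) =
      hA.eigenvalues i • hA.eigenvectorBasis i := by
    ext j
    simpa using congrFun (hA.mulVec_eigenvectorBasis i) j
  rw [← (isSymmetric_toEuclideanLin_iff.mpr hA) (hA.eigenvectorBasis i) x, hb,
    real_inner_smul_left, real_inner_comm]
  ring

lemma Matrix.IsHermitian.mul_norm_sq_le_inner_toEuclideanLin_self {n : Type*} [Fintype n]
    [DecidableEq n] {A : Matrix n n ℝ} (hA : A.IsHermitian) {c : ℝ}
    (hc : ∀ i, c ≤ hA.eigenvalues i) (x : EuclideanSpace ℝ n) :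
    c * ‖x‖ ^ 2 ≤ ⟪x, Matrix.toEuclideanLin A x⟫ := by
  rw [hA.inner_toEuclideanLin_self, ← hA.eigenvectorBasis.sum_sq_inner_right x, Finset.mul_sum]
  gcongr with i
  exact hc i

lemma Matrix.IsHermitian.inner_toEuclideanLin_self_le_mul_norm_sq {n : Type*} [Fintype n]
    [DecidableEq n] {A : Matrix n n ℝ} (hA : A.IsHermitian) {c : ℝ}
    (hc : ∀ i, hA.eigenvalues i ≤ c) (x : EuclideanSpace ℝ n) :
    ⟪x, Matrix.toEuclideanLin A x⟫ ≤ c * ‖x‖ ^ 2 := by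
  rw [hA.inner_toEuclideanLin_self, ← hA.eigenvectorBasis.sum_sq_inner_right x, Finset.mul_sum]
  gcongr with i
  exact hc i

lemma Matrix.toEuclideanLin_apply_inv_apply {n : Type*} [Fintype n] [DecidableEq n]
    {A : Matrix n n ℝ} (hA : IsUnit A) (x : EuclideanSpace ℝ n) :
    Matrix.toEuclideanLin A (Matrix.toEuclideanLin A⁻¹ x) = x := by
  ext j
  simp [Matrix.toLpLin_apply, Matrix.mulVec_mulVec,
    Matrix.mul_nonsing_inv A ((Matrix.isUnit_iff_isUnit_det A).mp hA)]

/-- **Lyapunov-derivative bound of Proposition 1.**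
Let `J` be a symmetric positive-definite real `3×3` matrix with smallest eigenvalue
`lammin` and largest eigenvalue `lammax`, let `d_max ≥ 0`, `β₁ > 0`, `0 < β₂ < 1`,
let `s ≠ 0` with `ŝ = s/‖s‖`, and let `d` be a disturbance with `‖d‖ ≤ d_max`.  Then
`sᵀ J (−J⁻¹(d_max·ŝ + d) − β₁‖s‖^β₂·ŝ) ≤ −β₁·λ_min(J)·‖s‖^(β₂+1)`, and setting
`V = (1/2)·sᵀ J s` this quantity is at most `−β₁·λ_min(J)·(2V/λ_max(J))^((β₂+1)/2)`. -/
theorem lyapunov_derivative_bound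
    (J : Matrix (Fin 3) (Fin 3) ℝ) (hJ : J.PosDef)
    (lammin lammax : ℝ)
    (hmin : lammin = Finset.univ.inf' Finset.univ_nonempty hJ.1.eigenvalues)
    (hmax : lammax = Finset.univ.sup' Finset.univ_nonempty hJ.1.eigenvalues)
    (d_max : ℝ) (hd_max : 0 ≤ d_max)
    (β₁ β₂ : ℝ) (hβ₁ : 0 < β₁) (hβ₂ : 0 < β₂ ∧ β₂ < 1)
    (s d : EuclideanSpace ℝ (Fin 3)) (hs : s ≠ 0) (hd : ‖d‖ ≤ d_max) :
    ⟪s, Matrix.toEuclideanLin J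
        (-(Matrix.toEuclideanLin J⁻¹ (d_max • ((‖s‖)⁻¹ • s) + d)) -
          (β₁ * ‖s‖ ^ β₂) • ((‖s‖)⁻¹ • s))⟫ ≤
      -(β₁ * lammin * ‖s‖ ^ (β₂ + 1)) ∧
    ⟪s, Matrix.toEuclideanLin J
        (-(Matrix.toEuclideanLin J⁻¹ (d_max • ((‖s‖)⁻¹ • s) + d)) -
          (β₁ * ‖s‖ ^ β₂) • ((‖s‖)⁻¹ • s))⟫ ≤
      -(β₁ * lammin *
        (2 * ((1 : ℝ) / 2 * ⟪s, Matrix.toEuclideanLin J s⟫) / lammax) ^ ((β₂ + 1) / 2)) := by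
  have hs0 : 0 < ‖s‖ := norm_pos_iff.mpr hs
  have hminle : ∀ i, lammin ≤ hJ.1.eigenvalues i := fun i =>
    hmin ▸ Finset.inf'_le _ (Finset.mem_univ i)
  have hmaxle : ∀ i, hJ.1.eigenvalues i ≤ lammax := fun i =>
    hmax ▸ Finset.le_sup' _ (Finset.mem_univ i)
  have hmin0 : 0 < lammin := by
    rw [hmin, Finset.lt_inf'_iff]
    exact fun i _ => hJ.eigenvalues_pos i
  have hmax0 : 0 < lammax := (hJ.eigenvalues_pos 0).trans_le (hmaxle 0)
  have hlow := hJ.1.mul_norm_sq_le_inner_toEuclideanLin_self hminle s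
  have hupp := hJ.1.inner_toEuclideanLin_self_le_mul_norm_sq hmaxle s
  have hdist : 0 ≤ ⟪s, d_max • (‖s‖⁻¹ • s) + d⟫ := by
    have hcs : -(‖s‖ * ‖d‖) ≤ ⟪s, d⟫ := neg_le_of_abs_le (abs_real_inner_le_norm s d)
    have hmul : ‖s‖ * ‖d‖ ≤ ‖s‖ * d_max := by gcongr
    have hself : ⟪s, d_max • (‖s‖⁻¹ • s)⟫ = ‖s‖ * d_max := by
      rw [real_inner_smul_right, real_inner_smul_right, real_inner_self_eq_norm_sq]
      field_simp
    rw [inner_add_right, hself]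
    linarith
  have hpow : ‖s‖ ^ (β₂ + 1) = ‖s‖ ^ β₂ * ‖s‖⁻¹ * ‖s‖ ^ 2 := by
    rw [Real.rpow_add_one hs0.ne']
    field_simp
  have hfirst : ⟪s, Matrix.toEuclideanLin J
      (-(Matrix.toEuclideanLin J⁻¹ (d_max • ((‖s‖)⁻¹ • s) + d)) -
        (β₁ * ‖s‖ ^ β₂) • ((‖s‖)⁻¹ • s))⟫ ≤ -(β₁ * lammin * ‖s‖ ^ (β₂ + 1)) := by
    rw [map_sub, map_neg, Matrix.toEuclideanLin_apply_inv_apply hJ.isUnit, map_smul, map_smul,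
      inner_sub_right, inner_neg_right, real_inner_smul_right, real_inner_smul_right, hpow]
    have hgain : 0 ≤ β₁ * ‖s‖ ^ β₂ * ‖s‖⁻¹ := by positivity
    linarith [mul_le_mul_of_nonneg_left hlow hgain]
  refine ⟨hfirst, hfirst.trans (neg_le_neg ?_)⟩
  have hV0 : 0 ≤ ⟪s, Matrix.toEuclideanLin J s⟫ := le_trans (by positivity) hlow
  have hβ : 0 ≤ (β₂ + 1) / 2 := by linarith [hβ₂.1]
  have hnorm : ‖s‖ ^ (β₂ + 1) = (‖s‖ ^ 2) ^ ((β₂ + 1) / 2) := by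
    rw [← Real.rpow_natCast, ← Real.rpow_mul hs0.le]
    congr 1
    push_cast
    ring
  rw [hnorm]
  gcongr
  rw [div_le_iff₀ hmax0]
  linarith
end

section
/- Let ω_D ∈ ℝ³, let ê ∈ ℝ³ be a unit vector, and let ω_max > 0 with ‖ω_D‖ < ω_max. Set a = ⟨ω_D, ê⟩ and D = a² + ω_max² − ‖ω_D‖². Then: (i) D > 0; (ii) the value ω* = −a + √D is strictly positive; (iii) ‖ω_D + ω*·ê‖ = ω_max; and (iv) for every ω ≥ 0 with ‖ω_D + ω·ê‖ ≤ ω_max one has ω ≤ ω*, i.e., ω* is the maximum regulating rate along ê compatible with the slew-rate bound (Eq. 22). -/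
open RealInnerProductSpace

theorem norm_add_smul_sq_of_norm_eq_one {E : Type*} [NormedAddCommGroup E]
    [InnerProductSpace ℝ E] (x : E) {e : E} (he : ‖e‖ = 1) (t : ℝ) :
    ‖x + t • e‖ ^ 2 = (t + ⟪x, e⟫) ^ 2 + ‖x‖ ^ 2 - ⟪x, e⟫ ^ 2 := by
  rw [norm_add_sq_real, real_inner_smul_right, norm_smul, he, mul_one, Real.norm_eq_abs, sq_abs]
  ring

/-- **Maximum regulating rate (Eq. 22).**
Let `ω_D ∈ ℝ³`, let `ê` be a unit vector, and let `ω_max > 0` with `‖ω_D‖ < ω_max`.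
With `a = ⟨ω_D, ê⟩` and `D = a² + ω_max² − ‖ω_D‖²`:
(i) `D > 0`; (ii) `ω* = −a + √D > 0`; (iii) `‖ω_D + ω*·ê‖ = ω_max`; and
(iv) every `ω ≥ 0` with `‖ω_D + ω·ê‖ ≤ ω_max` satisfies `ω ≤ ω*`, i.e. `ω*` is the
maximum regulating rate along `ê` compatible with the slew-rate bound. -/
theorem max_regulating_rate
    (ωD e : EuclideanSpace ℝ (Fin 3)) (ωmax : ℝ)
    (he : ‖e‖ = 1) (hωmax : 0 < ωmax) (hωD : ‖ωD‖ < ωmax) :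
    0 < ⟪ωD, e⟫ ^ 2 + ωmax ^ 2 - ‖ωD‖ ^ 2 ∧
    0 < -⟪ωD, e⟫ + Real.sqrt (⟪ωD, e⟫ ^ 2 + ωmax ^ 2 - ‖ωD‖ ^ 2) ∧
    ‖ωD + (-⟪ωD, e⟫ + Real.sqrt (⟪ωD, e⟫ ^ 2 + ωmax ^ 2 - ‖ωD‖ ^ 2)) • e‖ = ωmax ∧
    ∀ ω : ℝ, 0 ≤ ω → ‖ωD + ω • e‖ ≤ ωmax →
      ω ≤ -⟪ωD, e⟫ + Real.sqrt (⟪ωD, e⟫ ^ 2 + ωmax ^ 2 - ‖ωD‖ ^ 2) := by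
  have hsq : ‖ωD‖ ^ 2 < ωmax ^ 2 := by gcongr
  have hD : 0 < ⟪ωD, e⟫ ^ 2 + ωmax ^ 2 - ‖ωD‖ ^ 2 := by
    linarith [sq_nonneg ⟪ωD, e⟫]
  refine ⟨hD, ?_, ?_, fun ω _ hω => ?_⟩
  · have h : ⟪ωD, e⟫ < √(⟪ωD, e⟫ ^ 2 + ωmax ^ 2 - ‖ωD‖ ^ 2) :=
      Real.lt_sqrt_of_sq_lt (by linarith)
    linarith
  · rw [← sq_eq_sq₀ (norm_nonneg _) hωmax.le, norm_add_smul_sq_of_norm_eq_one ωD he,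
      neg_add_cancel_comm, Real.sq_sqrt hD.le]
    ring
  · have h : ‖ωD + ω • e‖ ^ 2 ≤ ωmax ^ 2 := by gcongr
    rw [norm_add_smul_sq_of_norm_eq_one ωD he] at h
    have h' : ω + ⟪ωD, e⟫ ≤ √(⟪ωD, e⟫ ^ 2 + ωmax ^ 2 - ‖ωD‖ ^ 2) :=
      Real.le_sqrt_of_sq_le (by linarith)
    linarith
end
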